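/- Let (Λ, 𝓑, μ) be a probability space and let A, B : ℝ → Λ → ℝ be such that for every angle γ ∈ ℝ the function A γ and B γ are measurable and satisfy |A γ x| ≤ 1 and |B γ x| ≤ 1 for all x ∈ Λ. Then for all angles a₁, a₂, b₁, b₂ ∈ ℝ, |∫ (A a₁ x · B b₁ x − A a₁ x · B b₂ x + A a₂ x · B b₁ x + A a₂ x · B b₂ x) dμ(x)| ≤ 2. (This is the CHSH bound S ≤ 2 for any local hidden-variable model satisfying realism, freedom and Bell locality.) -/

import Mathlib

open MeasureTheory

theorem abs_chsh_le_two {a a' b b' : ℝ} (ha : |a| ≤ 1) (ha' : |a'| ≤ 1)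
    (hb : |b| ≤ 1) (hb' : |b'| ≤ 1) :
    |a * b - a * b' + a' * b + a' * b'| ≤ 2 := by
  have hsum : |b - b'| + |b + b'| ≤ 2 := by
    rw [abs_le] at hb hb'
    rcases abs_cases (b - b') with h | h <;> rcases abs_cases (b + b') with h' | h' <;> linarith
  calc |a * b - a * b' + a' * b + a' * b'|
      = |a * (b - b') + a' * (b + b')| := by ring_nf
    _ ≤ |a| * |b - b'| + |a'| * |b + b'| := by
        simpa only [abs_mul] using abs_add_le (a * (b - b')) (a' * (b + b'))
    _ ≤ |b - b'| + |b + b'| :=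
        add_le_add (mul_le_of_le_one_left (abs_nonneg _) ha)
          (mul_le_of_le_one_left (abs_nonneg _) ha')
    _ ≤ 2 := hsum

theorem chsh_local_hidden_variable_bound
    {Λ : Type*} [MeasurableSpace Λ] (μ : Measure Λ) [IsProbabilityMeasure μ]
    (A B : ℝ → Λ → ℝ)
    (hA : ∀ γ : ℝ, Measurable (A γ)) (hB : ∀ γ : ℝ, Measurable (B γ))
    (hbA : ∀ (γ : ℝ) (x : Λ), |A γ x| ≤ 1) (hbB : ∀ (γ : ℝ) (x : Λ), |B γ x| ≤ 1)
    (a₁ a₂ b₁ b₂ : ℝ) :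
    |∫ x, (A a₁ x * B b₁ x - A a₁ x * B b₂ x + A a₂ x * B b₁ x + A a₂ x * B b₂ x) ∂μ| ≤ 2 := by
  have h := norm_integral_le_of_norm_le_const (μ := μ) (C := 2)
    (f := fun x => A a₁ x * B b₁ x - A a₁ x * B b₂ x + A a₂ x * B b₁ x + A a₂ x * B b₂ x)
    (Filter.Eventually.of_forall fun x =>
      abs_chsh_le_two (hbA a₁ x) (hbA a₂ x) (hbB b₁ x) (hbB b₂ x))
  simpa using h
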